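/- Let n ≥ 1 and let v = (v_1, …, v_n) ∈ ℝ^n satisfy v_i > (6n² + 1)v_{i+1} for all 1 ≤ i < n and v_n > 0. Let σ be a permutation of [n] with one-line notation σ_1σ_2…σ_n, let C_σ = {x ∈ ℝ^n : x_{σ_1} ≥ x_{σ_2} ≥ … ≥ x_{σ_n}}, and let p be the unique point of C_σ minimizing the Euclidean distance to v. Let Π(σ) be the ordered partition of [n] obtained by cutting the one-line notation of σ immediately after each right-to-left minimum (so each block is a maximal consecutive segment ending at a right-to-left minimum). Then for every i ∈ [n], the i-th coordinate of p equals the average of the coordinates of v over the block of Π(σ) containing i, and p_i = p_j if and only if i and j lie in the same block of Π(σ). -/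

import Mathlib

open Classical

/-- Position `c` holds a right-to-left minimum of `σ`. -/
def RLminPos {n : ℕ} (σ : Equiv.Perm (Fin n)) (c : Fin n) : Prop :=
  ∀ d : Fin n, c < d → σ c < σ d

/-- Values `i` and `j` lie in the same block of the ordered partition `Π(σ)` obtained by
cutting the one-line notation of `σ` immediately after every right-to-left minimum:
no position strictly between their positions (inclusive on the left) is a
right-to-left-minimum position. -/
def sameBlock {n : ℕ} (σ : Equiv.Perm (Fin n)) (i j : Fin n) : Prop :=
  ∀ c : Fin n, min (σ.symm i) (σ.symm j) ≤ c → c < max (σ.symm i) (σ.symm j) →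
    ¬ RLminPos σ c

/-- The block of `Π(σ)` containing the value `i`. -/
noncomputable def blockOf {n : ℕ} (σ : Equiv.Perm (Fin n)) (i : Fin n) : Finset (Fin n) :=
  Finset.univ.filter fun j => sameBlock σ i j

/-- Each value `i` has a smallest value `L i` among those standing weakly to its right, and two
values lie in the same block exactly when these smallest values agree. -/
theorem exists_blockMin {n : ℕ} (σ : Equiv.Perm (Fin n)) :
    ∃ L : Fin n → Fin n, (∀ i, σ.symm i ≤ σ.symm (L i)) ∧
      (∀ i j, σ.symm i ≤ σ.symm j → L i ≤ j) ∧ (∀ i j, sameBlock σ i j ↔ L i = L j) := by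
  have hex : ∀ i : Fin n, ∃ l, σ.symm i ≤ σ.symm l ∧ ∀ j, σ.symm i ≤ σ.symm j → l ≤ j := by
    intro i
    obtain ⟨l, hl, hl'⟩ := (Finset.univ.filter fun j => σ.symm i ≤ σ.symm j).exists_min_image id
      ⟨i, by simp⟩
    exact ⟨l, by simpa using hl, fun j hj => hl' j (by simpa using hj)⟩
  choose L hpos hle using hex
  have key : ∀ i j, σ.symm i ≤ σ.symm j → (sameBlock σ i j ↔ L i = L j) := by
    intro i j hij
    unfold sameBlock
    rw [min_eq_left hij, max_eq_right hij]
    constructor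
    · intro h
      refine le_antisymm (hle _ _ (hij.trans (hpos j))) (hle _ _ ?_)
      by_contra! hlt
      refine h _ (hpos i) hlt fun d hd => lt_of_le_of_ne ?_ ?_
      · rw [Equiv.apply_symm_apply]
        exact hle _ _ (by simpa using (hpos i).trans hd.le)
      · exact fun he => hd.ne (σ.injective he)
    · intro h c hc hcj hmin
      have h1 : σ c < L j := by
        simpa using hmin (σ.symm (L j)) (hcj.trans_le (hpos j))
      exact absurd (hle i (σ c) (by simpa using hc)) (by rw [h]; exact not_le.mpr h1)
  refine ⟨L, hpos, hle, fun i j => ?_⟩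
  rcases le_total (σ.symm i) (σ.symm j) with h | h
  · exact key i j h
  · rw [eq_comm, ← key j i h]
    unfold sameBlock
    rw [min_comm, max_comm]

/-- A finite real sequence with positive last entry, each of whose other entries exceeds
`6 * n ^ 2 + 1` times the next, is positive, and every entry exceeds `n` times any later one. -/
theorem pos_and_mul_lt_of_lacunary {n : ℕ} (hn : 1 ≤ n) (v : Fin n → ℝ)
    (hv : ∀ i j : Fin n, (j : ℕ) = i + 1 → (6 * (n : ℝ) ^ 2 + 1) * v j < v i)
    (hvn : ∀ i : Fin n, (i : ℕ) = n - 1 → 0 < v i) :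
    (∀ i, 0 < v i) ∧ ∀ i j, i < j → n * v j < v i := by
  have hn' : (1 : ℝ) ≤ n := by exact_mod_cast hn
  have hpos : ∀ k : ℕ, ∀ i : Fin n, i + k + 1 = n → 0 < v i := by
    intro k
    induction k with
    | zero => exact fun i hi => hvn i (by omega)
    | succ k ih =>
      intro i hi
      obtain ⟨j, hj⟩ : ∃ j : Fin n, (j : ℕ) = i + 1 := ⟨⟨i + 1, by omega⟩, rfl⟩
      have h1 := ih j (by omega)
      exact lt_trans (by positivity) (hv i j hj)
  have hpos' : ∀ i, 0 < v i := fun i => hpos (n - 1 - i) i (by have := i.2; omega)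
  have hstep : ∀ i j : Fin n, (j : ℕ) = i + 1 → n * v j < v i := by
    intro i j h
    refine lt_of_le_of_lt (mul_le_mul_of_nonneg_right ?_ (hpos' _).le) (hv i j h)
    nlinarith
  have hlt : ∀ k : ℕ, ∀ i j : Fin n, (j : ℕ) = i + k + 1 → n * v j < v i := by
    intro k
    induction k with
    | zero => exact hstep
    | succ k ih =>
      intro i j h
      obtain ⟨m, hm⟩ : ∃ m : Fin n, (m : ℕ) = i + k + 1 := ⟨⟨i + k + 1, by omega⟩, rfl⟩
      have h4 : v m ≤ n * v m := le_mul_of_one_le_left (hpos' m).le hn'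
      exact (hstep m j (by omega)).trans (h4.trans_lt (ih i m hm))
  exact ⟨hpos', fun i j hij => hlt (j - i - 1) i j (by have : (i : ℕ) < j := hij; omega)⟩

/-- The variational inequality `⟪v - q, p - q⟫ ≤ 0` forces a point `p` at least as close to `v` as
`q` to be `q`. -/
theorem eq_of_dist_le_of_inner_le_zero {E : Type*} [NormedAddCommGroup E] [InnerProductSpace ℝ E]
    {v p q : E} (hd : dist v p ≤ dist v q) (hi : inner ℝ (v - q) (p - q) ≤ 0) : p = q := by
  rw [dist_eq_norm, dist_eq_norm] at hd
  have h1 := norm_sub_sq_real (v - q) (p - q)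
  rw [sub_sub_sub_cancel_right] at h1
  have h2 : ‖v - p‖ ^ 2 ≤ ‖v - q‖ ^ 2 := pow_le_pow_left₀ (norm_nonneg _) hd 2
  have h3 : ‖p - q‖ ^ 2 ≤ 0 := by linarith
  have h4 : ‖p - q‖ = 0 := by
    have := sq_nonneg ‖p - q‖
    exact pow_eq_zero_iff two_ne_zero |>.mp (le_antisymm h3 this)
  exact sub_eq_zero.mp (norm_eq_zero.mp h4)

/-- Deviations from fibrewise averages are orthogonal to functions constant on fibres. -/
theorem sum_sub_average_mul_eq_zero {ι : Type*} [Fintype ι] [DecidableEq ι]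
    (L : ι → ι) (v f : ι → ℝ) :
    ∑ i, (v i - (∑ m with L i = L m, v m) / ((Finset.univ.filter fun m => L i = L m).card : ℝ))
      * f (L i) = 0 := by
  rw [← Finset.sum_fiberwise Finset.univ L]
  refine Finset.sum_eq_zero fun b _ => ?_
  rcases (Finset.univ.filter fun i => L i = b).eq_empty_or_nonempty with h | h
  · simp [h]
  have hc : ((Finset.univ.filter fun i => L i = b).card : ℝ) ≠ 0 := by
    exact_mod_cast h.card_pos.ne'
  have : ∀ i ∈ Finset.univ.filter fun i => L i = b,
      (v i - (∑ m with L i = L m, v m) / ((Finset.univ.filter fun m => L i = L m).card : ℝ))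
        * f (L i) =
      (v i - (∑ m with L m = b, v m) / ((Finset.univ.filter fun m => L m = b).card : ℝ))
        * f b := by
    intro i hi
    obtain rfl : L i = b := by simpa using hi
    simp only [eq_comm]
  rw [Finset.sum_congr rfl this, ← Finset.sum_mul, Finset.sum_sub_distrib, Finset.sum_const,
    nsmul_eq_mul, mul_div_cancel₀ _ hc, sub_self, zero_mul]

/-- for generic `v` (Equation vec2), the nearest point `p` of the closed
braid region of `σ` to `v` has coordinates given by averaging `v` over the blocks of
`Π(σ)` (the partition of `σ` at its right-to-left minima), and two coordinates of `p`
agree iff the indices lie in the same block of `Π(σ)`. -/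
theorem braid_projection_blocks {n : ℕ} (hn : 1 ≤ n)
    (v : EuclideanSpace ℝ (Fin n))
    (hv : ∀ i : ℕ, ∀ h : i + 1 < n, (6 * (n : ℝ) ^ 2 + 1) * v ⟨i + 1, h⟩ < v ⟨i, by omega⟩)
    (hvn : 0 < v ⟨n - 1, by omega⟩)
    (σ : Equiv.Perm (Fin n)) (p : EuclideanSpace ℝ (Fin n))
    (hp : ∀ s t : Fin n, s ≤ t → p (σ t) ≤ p (σ s))
    (hmin : ∀ x : EuclideanSpace ℝ (Fin n),
      (∀ s t : Fin n, s ≤ t → x (σ t) ≤ x (σ s)) → dist v p ≤ dist v x) :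
    (∀ i : Fin n, p i = (∑ m ∈ blockOf σ i, v m) / ((blockOf σ i).card : ℝ)) ∧
    (∀ i j : Fin n, p i = p j ↔ sameBlock σ i j) := by
  obtain ⟨L, hpos, hle, hL⟩ := exists_blockMin σ
  obtain ⟨v_pos, v_lt⟩ := pos_and_mul_lt_of_lacunary hn v
    (by rintro i ⟨_, hj⟩ rfl; exact hv i hj) (by rintro ⟨_, _⟩ rfl; exact hvn)
  have hn' : (1 : ℝ) ≤ n := by exact_mod_cast hn
  have hn0 : (0 : ℝ) < n := by linarith
  have v_anti : ∀ i j, i ≤ j → v j ≤ v i := by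
    intro i j hij
    rcases hij.eq_or_lt with rfl | h
    · exact le_rfl
    · exact (le_mul_of_one_le_left (v_pos j).le hn').trans (v_lt i j h).le
  have hblock : ∀ i, blockOf σ i = Finset.univ.filter fun m => L i = L m := fun i => by
    simp [blockOf, hL]
  have hLle : ∀ i, L i ≤ i := fun i => hle i i le_rfl
  have hLL : ∀ i, L (L i) = L i := fun i =>
    le_antisymm (hLle _) (hle _ _ ((hpos i).trans (hpos (L i))))
  let q : EuclideanSpace ℝ (Fin n) :=
    WithLp.toLp 2 fun i => (∑ m ∈ blockOf σ i, v m) / ((blockOf σ i).card : ℝ)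
  have hq : ∀ i, q i = (∑ m ∈ blockOf σ i, v m) / ((blockOf σ i).card : ℝ) := fun i => rfl
  have q_congr : ∀ i j, L i = L j → q i = q j := fun i j h => by
    rw [hq, hq, hblock, hblock, h]
  have card_pos : ∀ i, (0 : ℝ) < (blockOf σ i).card := fun i => by
    rw [hblock]
    exact_mod_cast Finset.card_pos.mpr ⟨i, by simp⟩
  have q_le : ∀ i, q i ≤ v (L i) := by
    intro i
    rw [hq, div_le_iff₀ (card_pos i), mul_comm, ← nsmul_eq_mul]
    refine Finset.sum_le_card_nsmul _ _ _ fun m hm => v_anti _ _ ?_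
    rw [hblock] at hm
    have : L i = L m := by simpa using hm
    exact this ▸ hLle m
  have le_q : ∀ i, v (L i) ≤ n * q i := by
    intro i
    have h1 : v (L i) ≤ ∑ m ∈ blockOf σ i, v m :=
      Finset.single_le_sum (f := fun m => v m) (fun m _ => (v_pos m).le)
        (by simp [hblock, hLL])
    have h2 : ((blockOf σ i).card : ℝ) ≤ n := by
      exact_mod_cast (Finset.card_le_univ _).trans_eq (Fintype.card_fin n)
    have h3 : ∑ m ∈ blockOf σ i, v m = (blockOf σ i).card * q i := by
      rw [hq, mul_div_cancel₀ _ (card_pos i).ne']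
    have h4 : 0 ≤ q i := div_nonneg (Finset.sum_nonneg fun m _ => (v_pos m).le) (card_pos i).le
    exact (h1.trans_eq h3).trans (mul_le_mul_of_nonneg_right h2 h4)
  have q_lt : ∀ i j, L i < L j → q j < q i := by
    intro i j h
    have h1 := v_lt _ _ h
    have h2 := le_q i
    exact (q_le j).trans_lt (lt_of_mul_lt_mul_left (h1.trans_le h2) hn0.le)
  have q_mem : ∀ s t : Fin n, s ≤ t → q (σ t) ≤ q (σ s) := by
    intro s t hst
    have h : L (σ s) ≤ L (σ t) := hle _ _ (by simpa using hst.trans (by simpa using hpos (σ t)))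
    rcases h.eq_or_lt with h | h
    · exact (q_congr _ _ h).ge
    · exact (q_lt _ _ h).le
  have hinner : inner ℝ (v - q) (p - q) ≤ 0 := by
    have h0 : ∑ i, (v i - q i) * (p (L i) - q (L i)) = 0 := by
      have h := sum_sub_average_mul_eq_zero L v fun i => p i - q i
      simpa only [hq, hblock] using h
    have h1 : inner ℝ (v - q) (p - q) = ∑ i, (v i - q i) * (p i - p (L i)) := by
      rw [← sub_zero (inner ℝ _ _), ← h0, PiLp.inner_apply, ← Finset.sum_sub_distrib]
      refine Finset.sum_congr rfl fun i _ => ?_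
      simp only [PiLp.sub_apply, RCLike.inner_apply, conj_trivial, q_congr _ _ (hLL i)]
      ring
    rw [h1]
    refine Finset.sum_nonpos fun i _ => ?_
    rcases (hLle i).eq_or_lt with h | h
    · simp [h]
    · refine mul_nonpos_of_nonpos_of_nonneg (sub_nonpos.mpr ?_) (sub_nonneg.mpr ?_)
      · exact (lt_of_mul_lt_mul_left ((v_lt _ _ h).trans_le (le_q i)) hn0.le).le
      · simpa using hp _ _ (hpos i)
  have hpq : p = q := eq_of_dist_le_of_inner_le_zero (hmin q q_mem) hinner
  subst hpq
  refine ⟨hq, fun i j => ?_⟩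
  rw [hL]
  refine ⟨fun h => ?_, q_congr i j⟩
  rcases lt_trichotomy (L i) (L j) with h' | h' | h'
  · exact absurd h (q_lt _ _ h').ne'
  · exact h'
  · exact absurd h (q_lt _ _ h').ne
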